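/- Let d ≥ 1 and let φ : ℕ → [0,∞) satisfy φ(0)=0, φ nondecreasing (condition (N)), the attractive condition (A): φ(l+m) ≤ φ(l)+φ(m), and the normalisation (SL): φ(n)/n → 0 (so that λ₀ = log(2d)). Then for every λ > λ₀ and every x ∈ ℝ^d the Lyapunov exponent satisfies ξ_λ(x) ≥ φ(1)·‖x‖₁. In particular, if φ(1) > 0, the limiting exponent ξ_{λ₀} = lim_{λ↓λ₀} ξ_λ is a strictly positive norm on ℝ^d. -/

import Mathlib

open scoped BigOperators ENNReal
open Filter Topology

noncomputable section

namespace SIRW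

abbrev Pt (d : ℕ) := Fin d → ℤ

variable {d : ℕ}

/-- A step of a nearest-neighbour walk: a vector of ℓ¹-norm one. -/
def IsStep (s : Pt d) : Prop := (∑ i, |s i|) = 1

/-- A nearest-neighbour path started at the origin, encoded by its list of steps. -/
def IsPath (γ : List (Pt d)) : Prop := ∀ s ∈ γ, IsStep s

/-- Position of the path after `k` steps (the path starts at the origin). -/
def pos (γ : List (Pt d)) (k : ℕ) : Pt d := (γ.take k).sum

/-- Displacement `D(γ) = γ(n) - γ(0)`. -/
def disp (γ : List (Pt d)) : Pt d := γ.sum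

/-- Local time of the path at the site `x`. -/
def locTime (γ : List (Pt d)) (x : Pt d) : ℕ :=
  ((Finset.range (γ.length + 1)).filter (fun k => pos γ k = x)).card

/-- The (finite) set of sites visited by the path. -/
def visited (γ : List (Pt d)) : Finset (Pt d) :=
  (Finset.range (γ.length + 1)).image (pos γ)

/-- Site potential `Φ(γ) = ∑_x φ(l_x(γ))`, for `φ : ℕ → [0,∞]` with `φ 0 = 0`. -/
def PotE (φ : ℕ → ℝ≥0∞) (γ : List (Pt d)) : ℝ≥0∞ :=
  ∑ x ∈ visited γ, φ (locTime γ x)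

/-- Site potential `Φ(γ) = ∑_x φ(l_x(γ))`, for real-valued `φ` with `φ 0 = 0`. -/
def PotR (φ : ℕ → ℝ) (γ : List (Pt d)) : ℝ :=
  ∑ x ∈ visited γ, φ (locTime γ x)

/-- `e^{-a}` for `a ∈ [0,∞]`, with `e^{-∞} = 0`. -/
def expNegE (a : ℝ≥0∞) : ℝ≥0∞ :=
  if a = ⊤ then 0 else ENNReal.ofReal (Real.exp (-a.toReal))

/-- `e^{a}` for `a ∈ [0,∞]`, with `e^{∞} = ∞`. -/
def expE (a : ℝ≥0∞) : ℝ≥0∞ :=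
  if a = ⊤ then ⊤ else ENNReal.ofReal (Real.exp a.toReal)

/-- Weight `W_λ(γ) = e^{-Φ(γ) - λ|γ|}` (extended-real-valued potential). -/
def wE (φ : ℕ → ℝ≥0∞) (lam : ℝ) (γ : List (Pt d)) : ℝ≥0∞ :=
  expNegE (PotE φ γ) * ENNReal.ofReal (Real.exp (-(lam * γ.length)))

/-- Weight `W_λ(γ) = e^{-Φ(γ) - λ|γ|}` (real-valued potential). -/
def wR (φ : ℕ → ℝ) (lam : ℝ) (γ : List (Pt d)) : ℝ≥0∞ :=
  ENNReal.ofReal (Real.exp (-PotR φ γ - lam * γ.length))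

/-- The set of `n`-step nearest-neighbour paths started at the origin. -/
def PathsN (d n : ℕ) : Set (List (Pt d)) := {γ | IsPath γ ∧ γ.length = n}

/-- Partition function `Z_n` (extended-real-valued potential). -/
def ZE (d : ℕ) (φ : ℕ → ℝ≥0∞) (n : ℕ) : ℝ≥0∞ :=
  ∑' γ : PathsN d n, expNegE (PotE φ (γ : List (Pt d)))

/-- Partition function `Z_n` (real-valued potential). -/
def ZR (d : ℕ) (φ : ℕ → ℝ) (n : ℕ) : ℝ≥0∞ :=
  ∑' γ : PathsN d n, ENNReal.ofReal (Real.exp (-PotR φ (γ : List (Pt d))))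

/-- Paths from `0` to `x`. -/
def Dpaths (x : Pt d) : Set (List (Pt d)) := {γ | IsPath γ ∧ disp γ = x}

/-- Paths from `0` to `x` hitting `x` only at their final point. -/
def Hpaths (x : Pt d) : Set (List (Pt d)) := {γ | IsPath γ ∧ disp γ = x ∧ locTime γ x = 1}

/-- Two-point function `D_λ(x)` (extended-real-valued potential). -/
def DEf (φ : ℕ → ℝ≥0∞) (lam : ℝ) (x : Pt d) : ℝ≥0∞ :=
  ∑' γ : Dpaths x, wE φ lam (γ : List (Pt d))

/-- Two-point function `H_λ(x)` (extended-real-valued potential). -/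
def HEf (φ : ℕ → ℝ≥0∞) (lam : ℝ) (x : Pt d) : ℝ≥0∞ :=
  ∑' γ : Hpaths x, wE φ lam (γ : List (Pt d))

/-- Two-point function `D_λ(x)` (real-valued potential). -/
def DRf (φ : ℕ → ℝ) (lam : ℝ) (x : Pt d) : ℝ≥0∞ :=
  ∑' γ : Dpaths x, wR φ lam (γ : List (Pt d))

/-- Two-point function `H_λ(x)` (real-valued potential). -/
def HRf (φ : ℕ → ℝ) (lam : ℝ) (x : Pt d) : ℝ≥0∞ :=
  ∑' γ : Hpaths x, wR φ lam (γ : List (Pt d))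

/-- Coercion of a lattice point to a real vector. -/
def ctR (x : Pt d) : Fin d → ℝ := fun i => (x i : ℝ)

/-- Componentwise floor `⌊M x⌋`. -/
def flr (M : ℝ) (x : Fin d → ℝ) : Pt d := fun i => ⌊M * x i⌋

/-- Euclidean scalar product on `ℝ^d`. -/
def inr (h x : Fin d → ℝ) : ℝ := ∑ i, h i * x i

/-- Euclidean norm on `ℝ^d`. -/
def nrm (x : Fin d → ℝ) : ℝ := Real.sqrt (∑ i, x i ^ 2)

/-- Wulff shape `K = {h : (h,x) ≤ ξ(x) ∀x}` associated with a norm `ξ`. -/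
def Kset (ξ : (Fin d → ℝ) → ℝ) : Set (Fin d → ℝ) := {h | ∀ x, inr h x ≤ ξ x}

/-- Weight `W_h(γ) = e^{-Φ(γ) + (h, D(γ))}` (extended-real-valued potential). -/
def wHE (φ : ℕ → ℝ≥0∞) (h : Fin d → ℝ) (γ : List (Pt d)) : ℝ≥0∞ :=
  expNegE (PotE φ γ) * ENNReal.ofReal (Real.exp (inr h (ctR (disp γ))))

/-- Partition function `Z_n^h` with drift `h` (extended-real-valued potential). -/
def ZHE (d : ℕ) (φ : ℕ → ℝ≥0∞) (h : Fin d → ℝ) (n : ℕ) : ℝ≥0∞ :=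
  ∑' γ : PathsN d n, wHE φ h (γ : List (Pt d))

/-- Weight `W_h(γ) = e^{-Φ(γ) + (h, D(γ))}` (real-valued potential). -/
def wHR (φ : ℕ → ℝ) (h : Fin d → ℝ) (γ : List (Pt d)) : ℝ≥0∞ :=
  ENNReal.ofReal (Real.exp (-PotR φ γ + inr h (ctR (disp γ))))

/-- Partition function `Z_n^h` with drift `h` (real-valued potential). -/
def ZHR (d : ℕ) (φ : ℕ → ℝ) (h : Fin d → ℝ) (n : ℕ) : ℝ≥0∞ :=
  ∑' γ : PathsN d n, wHR φ h (γ : List (Pt d))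

/-- Condition (SL) for an extended-real-valued potential: finiteness and sublinearity. -/
def SLE (φ : ℕ → ℝ≥0∞) : Prop :=
  (∀ n, φ n ≠ ⊤) ∧ Tendsto (fun n : ℕ => (φ n).toReal / n) atTop (𝓝 0)

/-- Forward cone `Y^>_δ(h) = {y : s_h(y) < δ ξ(y)}`, where `s_h(y) = ξ(y) - (h,y)`. -/
def Ygt (ξ : (Fin d → ℝ) → ℝ) (h : Fin d → ℝ) (δ : ℝ) : Set (Pt d) :=
  {y | ξ (ctR y) - inr h (ctR y) < δ * ξ (ctR y)}

/-- `γ(k)` is an `(h,δ)`-cone point of `γ`: the whole path lies in the union of the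
forward and backward cones of aperture `3δ` centred at `γ(k)`. -/
def IsConePt (ξ : (Fin d → ℝ) → ℝ) (h : Fin d → ℝ) (δ : ℝ) (γ : List (Pt d)) (k : ℕ) : Prop :=
  k ≤ γ.length ∧ ∀ j ≤ γ.length, j ≠ k →
    ((pos γ j - pos γ k) ∈ Ygt ξ h (3 * δ) ∨ (pos γ k - pos γ j) ∈ Ygt ξ h (3 * δ))

open scoped Classical in
/-- The number of `(h,δ)`-cone points of the path `γ`. -/
def coneCount (ξ : (Fin d → ℝ) → ℝ) (h : Fin d → ℝ) (δ : ℝ) (γ : List (Pt d)) : ℕ :=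
  ((Finset.range (γ.length + 1)).filter (fun k => IsConePt ξ h δ γ k)).card

/-- Unoriented edges traversed by the path `γ` started at the point `a`. -/
def pathEdges (a : Pt d) (γ : List (Pt d)) : Set (Sym2 (Pt d)) :=
  {e | ∃ k < γ.length, e = s(a + pos γ k, a + pos γ (k + 1))}

/-- Starting point of the `i`-th piece in the concatenation of the paths `γv 0, …, γv (m-1)`. -/
def famStart {m : ℕ} (γv : Fin m → List (Pt d)) (i : Fin m) : Pt d :=
  ∑ j ∈ Finset.univ.filter (fun j : Fin m => j < i), disp (γv j)

/-- The pieces `γv 0, …, γv (m-1)` of a concatenation are edge-disjoint. -/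
def EdgeDisjointFam {m : ℕ} (γv : Fin m → List (Pt d)) : Prop :=
  ∀ i j : Fin m, i ≠ j →
    Disjoint (pathEdges (famStart γv i) (γv i)) (pathEdges (famStart γv j) (γv j))

/-- Concatenation `γ₁ ∪ ⋯ ∪ γ_m` of paths (as step lists). -/
def concatFam {m : ℕ} (γv : Fin m → List (Pt d)) : List (Pt d) := (List.ofFn γv).flatten

/-- Perturbed weight `e^{-Φ(γ) - R(γ,g) + (g, D(γ))}`. -/
def wPert (φ : ℕ → ℝ≥0∞) (Rp : List (Pt d) → (Fin d → ℝ) → ℝ) (g : Fin d → ℝ)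
    (γ : List (Pt d)) : ℝ≥0∞ :=
  expNegE (PotE φ γ) * ENNReal.ofReal (Real.exp (-Rp γ g + inr g (ctR (disp γ))))

/-- Perturbed partition function `Z̃_n^g`. -/
def ZPert (d : ℕ) (φ : ℕ → ℝ≥0∞) (Rp : List (Pt d) → (Fin d → ℝ) → ℝ)
    (g : Fin d → ℝ) (n : ℕ) : ℝ≥0∞ :=
  ∑' γ : PathsN d n, wPert φ Rp g (γ : List (Pt d))

/-- The segment of `γ` of length `p` started at time `l` matches the pattern
`(u 0, …, u p)` up to a shift. -/
def patMatch (u : ℕ → Pt d) (p : ℕ) (γ : List (Pt d)) (l : ℕ) : Prop :=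
  ∀ j ≤ p, pos γ (l + j) - pos γ l = u j - u 0

open scoped Classical in
/-- Number of occurrences `N_η(γ)` of the pattern `η = (u 0, …, u p)` in `γ`. -/
def Npat (u : ℕ → Pt d) (p : ℕ) (γ : List (Pt d)) : ℕ :=
  ((Finset.range (γ.length + 1 - p)).filter (fun l => patMatch u p γ l)).card

/-- The gradient vector of `f : ℝ^d → ℝ` at `g`. -/
def gradVec (f : (Fin d → ℝ) → ℝ) (g : Fin d → ℝ) : Fin d → ℝ :=
  fun i => fderiv ℝ f g (Pi.single i 1)

end SIRW

open SIRW

/-! ### Helper lemmas -/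

def n1 {d : ℕ} (x : Pt d) : ℕ := ∑ i, (x i).natAbs

lemma n1_add {d : ℕ} (x y : Pt d) : n1 (x + y) ≤ n1 x + n1 y := by
  unfold n1
  rw [← Finset.sum_add_distrib]
  exact Finset.sum_le_sum fun i _ => Int.natAbs_add_le _ _

lemma n1_zero {d : ℕ} : n1 (0 : Pt d) = 0 := by simp [n1]

lemma isStep_iff {d : ℕ} (s : Pt d) : IsStep s ↔ n1 s = 1 := by
  unfold IsStep n1
  rw [← Nat.cast_inj (R := ℤ)]
  push_cast
  rfl

lemma n1_sum_le {d : ℕ} (γ : List (Pt d)) (h : IsPath γ) : n1 γ.sum ≤ γ.length := by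
  induction γ with
  | nil => simp [n1_zero]
  | cons a l ih =>
    have h1 : n1 a = 1 := (isStep_iff a).1 (h a (by simp))
    have h2 := ih (fun s hs => h s (by simp [hs]))
    have h3 := n1_add a l.sum
    simp only [List.sum_cons, List.length_cons]
    omega

lemma isPath_take {d : ℕ} {γ : List (Pt d)} (h : IsPath γ) (k : ℕ) : IsPath (γ.take k) :=
  fun s hs => h s (List.mem_of_mem_take hs)

lemma n1_pos_succ {d : ℕ} {γ : List (Pt d)} (h : IsPath γ) (k : ℕ) :
    n1 (pos γ (k + 1)) ≤ n1 (pos γ k) + 1 := by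
  unfold pos
  by_cases hk : k < γ.length
  · rw [List.take_add_one, List.getElem?_eq_getElem hk, List.sum_append]
    refine (n1_add _ _).trans ?_
    have : n1 γ[k] = 1 := (isStep_iff _).1 (h _ (List.getElem_mem hk))
    simp [this]
  · rw [List.take_of_length_le (by omega), List.take_of_length_le (by omega)]
    omega

lemma card_visited {d : ℕ} {γ : List (Pt d)} (h : IsPath γ) :
    n1 (disp γ) + 1 ≤ (visited γ).card := by
  have key : ∀ k, Finset.range (n1 (pos γ k) + 1) ⊆
      ((Finset.range (k + 1)).image (pos γ)).image n1 := by
    intro k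
    induction k with
    | zero =>
      simp [pos, n1_zero]
    | succ k ih =>
      intro v hv
      have h1 := n1_pos_succ h k
      rw [Finset.mem_range] at hv
      by_cases hv' : v = n1 (pos γ (k + 1))
      · subst hv'
        exact Finset.mem_image_of_mem _ (Finset.mem_image_of_mem _ (by simp))
      · have := ih (Finset.mem_range.2 (show v < n1 (pos γ k) + 1 by omega))
        refine Finset.image_subset_image (Finset.image_subset_image ?_) this
        exact Finset.range_subset_range.2 (by omega)
  have h2 := Finset.card_le_card (key γ.length)
  have h3 : pos γ γ.length = disp γ := by simp [pos, disp]
  rw [Finset.card_range, h3] at h2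
  exact h2.trans Finset.card_image_le

lemma PotR_lower {d : ℕ} {φ : ℕ → ℝ} (hpos : ∀ n, 0 ≤ φ n) (hm : Monotone φ)
    {γ : List (Pt d)} (h : IsPath γ) : φ 1 * n1 (disp γ) ≤ PotR φ γ := by
  have h1 : ((visited γ).card : ℝ) * φ 1 ≤ PotR φ γ := by
    unfold PotR
    rw [← nsmul_eq_mul]
    refine Finset.card_nsmul_le_sum _ _ _ fun x hx => hm ?_
    unfold visited at hx
    obtain ⟨k, hk, rfl⟩ := Finset.mem_image.1 hx
    exact Finset.card_pos.2 ⟨k, Finset.mem_filter.2 ⟨hk, rfl⟩⟩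
  have h2 : (n1 (disp γ) : ℝ) ≤ (visited γ).card := by
    exact_mod_cast (Nat.le_succ _).trans (card_visited h)
  nlinarith [hpos 1]

lemma PotR_nonneg {d : ℕ} {φ : ℕ → ℝ} (hpos : ∀ n, 0 ≤ φ n) (γ : List (Pt d)) :
    0 ≤ PotR φ γ := Finset.sum_nonneg fun _ _ => hpos _

/-- The finite set of steps. -/
lemma steps_finite (d : ℕ) : {s : Pt d | IsStep s}.Finite := by
  refine (Set.Finite.pi' (ι := Fin d) (t := fun _ => Set.Icc (-1 : ℤ) 1)
    (fun _ => Set.finite_Icc _ _)).subset ?_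
  intro s hs i
  have h1 : |s i| ≤ 1 := by
    rw [← (show (∑ i, |s i|) = 1 from hs)]
    exact Finset.single_le_sum (f := fun i => |s i|) (fun _ _ => abs_nonneg _) (Finset.mem_univ i)
  exact abs_le.1 h1

def stepF (d : ℕ) : Finset (Pt d) := (steps_finite d).toFinset

lemma mem_stepF {d : ℕ} (s : Pt d) : s ∈ stepF d ↔ IsStep s := by simp [stepF]

lemma single_step {d : ℕ} (i : Fin d) (e : ℤ) (he : |e| = 1) : IsStep (Pi.single i e : Pt d) := by
  unfold IsStep
  rw [Finset.sum_eq_single i]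
  · simpa using he
  · intro j _ hj; simp [hj]
  · simp

lemma stepF_card_pos {d : ℕ} (hd : 1 ≤ d) : 1 ≤ (stepF d).card :=
  Finset.card_pos.2 ⟨Pi.single ⟨0, hd⟩ 1, (mem_stepF _).2 (single_step _ _ (by simp))⟩

def pathF (d : ℕ) : ℕ → Finset (List (Pt d))
  | 0 => {[]}
  | n + 1 => (stepF d ×ˢ pathF d n).image fun p => p.1 :: p.2

lemma mem_pathF {d : ℕ} (n : ℕ) (γ : List (Pt d)) : γ ∈ pathF d n ↔ γ ∈ PathsN d n := by
  induction n generalizing γ with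
  | zero =>
    simp only [pathF, Finset.mem_singleton, PathsN, Set.mem_setOf_eq, List.length_eq_zero_iff]
    constructor
    · rintro rfl; exact ⟨by simp [IsPath], rfl⟩
    · exact fun h => h.2
  | succ n ih =>
    cases γ with
    | nil => simp [pathF, PathsN]
    | cons a l =>
      simp only [pathF, Finset.mem_image, Finset.mem_product, Prod.exists, List.cons.injEq]
      constructor
      · rintro ⟨a', l', ⟨h1, h2⟩, rfl, rfl⟩
        obtain ⟨h3, h4⟩ := (ih _).1 h2
        refine ⟨?_, by simp [h4]⟩
        intro s hs
        rcases List.mem_cons.1 hs with rfl | hs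
        · exact (mem_stepF _).1 h1
        · exact h3 s hs
      · rintro ⟨h1, h2⟩
        refine ⟨a, l, ⟨(mem_stepF _).2 (h1 a (by simp)), (ih _).2 ⟨fun s hs => h1 s (by simp [hs]),
          by simpa using h2⟩⟩, rfl, rfl⟩

lemma card_pathF {d : ℕ} (n : ℕ) : (pathF d n).card = (stepF d).card ^ n := by
  induction n with
  | zero => simp [pathF]
  | succ n ih =>
    rw [pathF, Finset.card_image_of_injective, Finset.card_product, ih, pow_succ, mul_comm]
    rintro ⟨a, l⟩ ⟨a', l'⟩ h
    simpa using h

lemma tsum_PathsN {d : ℕ} (n : ℕ) (f : List (Pt d) → ℝ≥0∞) :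
    ∑' γ : PathsN d n, f γ = ∑ γ ∈ pathF d n, f γ := by
  rw [← Finset.tsum_subtype]
  have : (PathsN d n) = ((pathF d n : Finset _) : Set (List (Pt d))) := by
    ext γ; simp [mem_pathF]
  rw [this]
  rfl

/-! ### Upper bound on the two-point function -/

lemma HRf_upper {d : ℕ} {φ : ℕ → ℝ} (hpos : ∀ n, 0 ≤ φ n) (hm : Monotone φ)
    (lam : ℝ) (y : Pt d) :
    HRf φ lam y ≤ ENNReal.ofReal (Real.exp (-(φ 1 * n1 y))) *
      ∑' n : ℕ, (ENNReal.ofReal ((stepF d).card * Real.exp (-lam))) ^ n := by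
  have hsub : Hpaths y ⊆ ⋃ n : ℕ, (Hpaths y ∩ PathsN d n) := by
    intro γ hγ
    exact Set.mem_iUnion.2 ⟨γ.length, hγ, hγ.1, rfl⟩
  have hterm : ∀ n : ℕ, ∑' γ : ↥(Hpaths y ∩ PathsN d n), wR φ lam (γ : List (Pt d)) ≤
      ENNReal.ofReal (Real.exp (-(φ 1 * n1 y))) *
        (ENNReal.ofReal ((stepF d).card * Real.exp (-lam))) ^ n := by
    intro n
    obtain ⟨c, hc⟩ : ∃ c : ℝ≥0∞,
      c = ENNReal.ofReal (Real.exp (-(φ 1 * n1 y)) * Real.exp (-lam) ^ n) := ⟨_, rfl⟩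
    have h1 : ∑' γ : ↥(Hpaths y ∩ PathsN d n), wR φ lam (γ : List (Pt d))
        ≤ ∑' γ : ↥(Hpaths y ∩ PathsN d n), (fun _ : List (Pt d) => c) γ := by
      refine ENNReal.tsum_le_tsum ?_
      rintro ⟨γ, h1, h2⟩
      unfold wR
      rw [hc]
      refine ENNReal.ofReal_le_ofReal ?_
      rw [← Real.exp_nat_mul, ← Real.exp_add]
      refine Real.exp_le_exp.2 ?_
      have h3 := PotR_lower hpos hm h1.1
      rw [h1.2.1] at h3
      simp only [h2.2]
      linarith
    have h2 : ∑' γ : ↥(Hpaths y ∩ PathsN d n), (fun _ : List (Pt d) => c) γ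
        ≤ ∑' γ : PathsN d n, (fun _ : List (Pt d) => c) γ :=
      ENNReal.tsum_mono_subtype (fun _ : List (Pt d) => c) Set.inter_subset_right
    refine (h1.trans h2).trans (le_of_eq ?_)
    rw [tsum_PathsN n (fun _ : List (Pt d) => c), Finset.sum_const, card_pathF, nsmul_eq_mul, hc,
      ENNReal.ofReal_mul (Real.exp_pos _).le, ENNReal.ofReal_mul (Nat.cast_nonneg _),
      ENNReal.ofReal_pow (Real.exp_pos _).le, mul_pow, ENNReal.ofReal_natCast, Nat.cast_pow]
    exact mul_left_comm _ _ _
  have e1 : HRf φ lam y ≤ ∑' γ : ↥(⋃ n : ℕ, (Hpaths y ∩ PathsN d n)), wR φ lam (γ : List (Pt d)) :=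
    ENNReal.tsum_mono_subtype (fun γ => wR φ lam γ) hsub
  have e2 : ∑' γ : ↥(⋃ n : ℕ, (Hpaths y ∩ PathsN d n)), wR φ lam (γ : List (Pt d)) ≤
      ∑' n : ℕ, ∑' γ : ↥(Hpaths y ∩ PathsN d n), wR φ lam (γ : List (Pt d)) :=
    ENNReal.tsum_iUnion_le_tsum (fun γ => wR φ lam γ) _
  rw [← ENNReal.tsum_mul_left]
  exact (e1.trans e2).trans (ENNReal.tsum_le_tsum hterm)

lemma Dpaths_nonempty {d : ℕ} (y : Pt d) : (Dpaths y).Nonempty := by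
  have hadd : ∀ x y : Pt d, (Dpaths x).Nonempty → (Dpaths y).Nonempty →
      (Dpaths (x + y)).Nonempty := by
    rintro x y ⟨a, ha, ha'⟩ ⟨b, hb, hb'⟩
    refine ⟨a ++ b, ?_, ?_⟩
    · intro s hs
      rcases List.mem_append.1 hs with h | h
      · exact ha s h
      · exact hb s h
    · simp only [disp] at *
      simp [ha', hb']
  have h0 : (Dpaths (0 : Pt d)).Nonempty := ⟨[], by simp [IsPath], by simp [disp]⟩
  have hn : ∀ (i : Fin d) (e : ℤ), |e| = 1 → ∀ n : ℕ,
      (Dpaths (Pi.single i ((n : ℤ) * e) : Pt d)).Nonempty := by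
    intro i e he n
    induction n with
    | zero => simpa using h0
    | succ n ih =>
      have h1 : (Dpaths (Pi.single i e : Pt d)).Nonempty :=
        ⟨[Pi.single i e], by simpa [IsPath] using single_step i e he, by simp [disp]⟩
      rw [show ((n + 1 : ℕ) : ℤ) * e = n * e + e by push_cast; ring, Pi.single_add]
      exact hadd _ _ ih h1
  have hz : ∀ (i : Fin d) (z : ℤ), (Dpaths (Pi.single i z : Pt d)).Nonempty := by
    intro i z
    rcases Int.natAbs_eq z with h | h
    · rw [h]; simpa using hn i 1 (by simp) z.natAbs
    · rw [h]; simpa using hn i (-1) (by simp) z.natAbs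
  have hs : ∀ s : Finset (Fin d), (Dpaths (∑ i ∈ s, (Pi.single i (y i) : Pt d))).Nonempty := by
    intro s
    classical
    induction s using Finset.induction_on with
    | empty => simpa using h0
    | insert a s ha ih =>
      rw [Finset.sum_insert ha]
      exact hadd _ _ (hz _ _) ih
  have := hs Finset.univ
  rwa [Finset.univ_sum_single] at this

lemma Hpaths_nonempty {d : ℕ} (y : Pt d) : (Hpaths y).Nonempty := by
  classical
  have hex : ∃ n, ∃ γ ∈ Dpaths y, γ.length = n := by
    obtain ⟨γ, h⟩ := Dpaths_nonempty y
    exact ⟨_, γ, h, rfl⟩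
  obtain ⟨γ, hγ, hlen⟩ := Nat.find_spec hex
  refine ⟨γ, hγ.1, hγ.2, ?_⟩
  unfold locTime
  rw [Finset.card_eq_one]
  refine ⟨γ.length, ?_⟩
  ext k
  simp only [Finset.mem_filter, Finset.mem_range, Finset.mem_singleton]
  constructor
  · rintro ⟨h1, h2⟩
    by_contra hne
    refine Nat.find_min hex (m := k) (by omega) ⟨γ.take k, ⟨isPath_take hγ.1 k, h2⟩, ?_⟩
    rw [List.length_take]; omega
  · rintro rfl
    refine ⟨by omega, ?_⟩
    have : pos γ γ.length = disp γ := by simp [pos, disp]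
    rw [this]; exact hγ.2

lemma HRf_pos {d : ℕ} (φ : ℕ → ℝ) (lam : ℝ) (y : Pt d) : HRf φ lam y ≠ 0 := by
  obtain ⟨γ, hγ⟩ := Hpaths_nonempty y
  intro h
  unfold HRf at h
  rw [ENNReal.tsum_eq_zero] at h
  have := h ⟨γ, hγ⟩
  simp only [wR, ENNReal.ofReal_eq_zero] at this
  exact absurd this (not_le.2 (Real.exp_pos _))

/-! ### Lower bound on `λ₀` -/

lemma ZR_lt_top {d : ℕ} (φ : ℕ → ℝ) (n : ℕ) : ZR d φ n ≠ ⊤ := by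
  unfold ZR
  rw [tsum_PathsN n (fun γ => ENNReal.ofReal (Real.exp (-PotR φ γ)))]
  exact ENNReal.sum_ne_top.2 fun _ _ => ENNReal.ofReal_ne_top

lemma n1_neg {d : ℕ} (x : Pt d) : n1 (-x) = n1 x := by simp [n1]

lemma sum_map_neg {d : ℕ} (l : List (Pt d)) : (l.map (fun s => -s)).sum = -l.sum := by
  induction l with
  | nil => simp
  | cons a l ih => simp [ih]; abel

/-- Finset of many confined paths built by concatenating loops. -/
def confF {d : ℕ} (A : Finset (List (Pt d))) : ℕ → Finset (List (Pt d))
  | 0 => {[]}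
  | m + 1 => (A ×ˢ (A ×ˢ confF A m)).image
      fun p => p.1 ++ (p.2.1.map (fun s => -s) ++ p.2.2)

lemma card_confF {d : ℕ} (A : Finset (List (Pt d))) (k : ℕ) (hA : ∀ a ∈ A, a.length = k)
    (m : ℕ) : (confF A m).card = A.card ^ (2 * m) := by
  induction m with
  | zero => simp [confF]
  | succ m ih =>
    rw [confF, Finset.card_image_of_injOn, Finset.card_product, Finset.card_product, ih]
    · ring
    · rintro ⟨a, b, l⟩ h ⟨a', b', l'⟩ h' heq
      simp only [Finset.coe_product, Set.mem_prod, Finset.mem_coe] at h h'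
      obtain ⟨h1, h2⟩ := List.append_inj heq (by rw [hA _ h.1, hA _ h'.1])
      obtain ⟨h3, h4⟩ := List.append_inj h2 (by simp [hA _ h.2.1, hA _ h'.2.1])
      have h5 : b = b' := List.map_injective_iff.2 neg_injective h3
      simp only at h1 h4
      rw [h1, h4, h5]

lemma confF_prop {d : ℕ} (A : Finset (List (Pt d))) (k : ℕ) (y : Pt d)
    (hA : ∀ a ∈ A, IsPath a ∧ a.length = k ∧ a.sum = y) (m : ℕ) :
    ∀ γ ∈ confF A m, IsPath γ ∧ γ.length = 2 * k * m ∧ ∀ j, n1 (pos γ j) ≤ 2 * k := by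
  induction m with
  | zero =>
    intro γ hγ
    simp only [confF, Finset.mem_singleton] at hγ
    subst hγ
    exact ⟨by simp [IsPath], by simp, by simp [pos, n1_zero]⟩
  | succ m ih =>
    intro γ hγ
    simp only [confF, Finset.mem_image, Finset.mem_product, Prod.exists] at hγ
    obtain ⟨a, b, l, ⟨ha, hb, hl⟩, rfl⟩ := hγ
    obtain ⟨ha1, ha2, ha3⟩ := hA a ha
    obtain ⟨hb1, hb2, hb3⟩ := hA b hb
    obtain ⟨hl1, hl2, hl3⟩ := ih l hl
    have hp : IsPath (a ++ (b.map (fun s => -s) ++ l)) := by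
      intro s hs
      rcases List.mem_append.1 hs with h | h
      · exact ha1 s h
      rcases List.mem_append.1 h with h | h
      · obtain ⟨t, ht, rfl⟩ := List.mem_map.1 h
        rw [isStep_iff, n1_neg, ← isStep_iff]
        exact hb1 t ht
      · exact hl1 s h
    refine ⟨hp, ?_, ?_⟩
    · simp only [List.length_append, List.length_map, ha2, hb2, hl2]; ring
    · intro j
      by_cases hj : j ≤ 2 * k
      · refine (n1_sum_le _ (isPath_take hp j)).trans ?_
        rw [List.length_take]; omega
      · have : pos (a ++ (b.map (fun s => -s) ++ l)) j = pos l (j - 2 * k) := by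
          unfold pos
          rw [List.take_append, List.take_append, List.take_of_length_le (by omega),
            List.take_of_length_le (by simp; omega)]
          simp only [List.sum_append, sum_map_neg, ha3, hb3, List.length_map, ha2, hb2]
          rw [show j - k - k = j - 2 * k by omega]
          abel
        rw [this]; exact hl3 _

def box (d K : ℕ) : Finset (Pt d) := Fintype.piFinset fun _ => Finset.Icc (-(K : ℤ)) K

lemma card_box (d K : ℕ) : (box d K).card = (2 * K + 1) ^ d := by
  simp only [box, Fintype.card_piFinset, Int.card_Icc, Finset.prod_const, Finset.card_univ,
    Fintype.card_fin]
  congr 1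
  omega

lemma mem_box {d K : ℕ} (x : Pt d) (h : n1 x ≤ K) : x ∈ box d K := by
  simp only [box, Fintype.mem_piFinset, Finset.mem_Icc]
  intro i
  have : (x i).natAbs ≤ n1 x :=
    Finset.single_le_sum (f := fun i => (x i).natAbs) (fun _ _ => Nat.zero_le _) (Finset.mem_univ i)
  omega

lemma PotR_upper {d : ℕ} {φ : ℕ → ℝ} (hpos : ∀ n, 0 ≤ φ n) (hm : Monotone φ)
    {γ : List (Pt d)} {K : ℕ} (h : ∀ j, n1 (pos γ j) ≤ K) :
    PotR φ γ ≤ (2 * K + 1) ^ d * φ (γ.length + 1) := by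
  have h1 : PotR φ γ ≤ (visited γ).card • φ (γ.length + 1) := by
    unfold PotR
    refine Finset.sum_le_card_nsmul _ _ _ fun x _ => hm ?_
    unfold locTime
    exact (Finset.card_filter_le _ _).trans (by simp)
  have h2 : (visited γ).card ≤ (2 * K + 1) ^ d := by
    rw [← card_box]
    refine Finset.card_le_card ?_
    intro x hx
    obtain ⟨k, _, rfl⟩ := Finset.mem_image.1 hx
    exact mem_box _ (h k)
  rw [nsmul_eq_mul] at h1
  refine h1.trans (mul_le_mul_of_nonneg_right ?_ (hpos _))
  exact_mod_cast h2

lemma exists_end {d : ℕ} (k : ℕ) : ∃ y : Pt d,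
    (stepF d).card ^ k ≤ (2 * k + 1) ^ d * ((pathF d k).filter fun γ => γ.sum = y).card := by
  by_contra! hcon
  have h1 : (pathF d k).card = ∑ y ∈ box d k, ((pathF d k).filter fun γ => γ.sum = y).card := by
    refine Finset.card_eq_sum_card_fiberwise ?_
    intro γ hγ
    obtain ⟨h2, h3⟩ := (mem_pathF k γ).1 hγ
    refine mem_box _ ?_
    rw [← h3]; exact n1_sum_le _ h2
  have hb : 0 < (box d k).card := by rw [card_box]; positivity
  have h4 : ∑ y ∈ box d k, (2 * k + 1) ^ d * ((pathF d k).filter fun γ => γ.sum = y).card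
      < ∑ y ∈ box d k, (stepF d).card ^ k :=
    Finset.sum_lt_sum_of_nonempty (Finset.card_pos.1 hb) fun y _ => hcon y
  rw [← Finset.mul_sum, ← h1, card_pathF, Finset.sum_const, card_box, smul_eq_mul] at h4
  exact lt_irrefl _ h4

lemma ZR_lower {d : ℕ} {φ : ℕ → ℝ} (hpos : ∀ n, 0 ≤ φ n) (hm : Monotone φ)
    (A : Finset (List (Pt d))) (k : ℕ) (y : Pt d)
    (hA : ∀ a ∈ A, IsPath a ∧ a.length = k ∧ a.sum = y) (m : ℕ) :
    (A.card : ℝ) ^ (2 * m) * Real.exp (-((2 * (2 * k : ℕ) + 1) ^ d * φ (2 * k * m + 1)))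
      ≤ (ZR d φ (2 * k * m)).toReal := by
  rw [← ENNReal.ofReal_le_iff_le_toReal (ZR_lt_top _ _)]
  unfold ZR
  rw [tsum_PathsN _ (fun γ => ENNReal.ofReal (Real.exp (-PotR φ γ)))]
  have hsub : confF A m ⊆ pathF d (2 * k * m) := by
    intro γ hγ
    obtain ⟨h1, h2, _⟩ := confF_prop A k y hA m γ hγ
    exact (mem_pathF _ _).2 ⟨h1, h2⟩
  refine le_trans ?_ (Finset.sum_le_sum_of_subset hsub)
  refine le_trans ?_ (Finset.card_nsmul_le_sum _ _
    (ENNReal.ofReal (Real.exp (-((2 * (2 * k : ℕ) + 1) ^ d * φ (2 * k * m + 1))))) ?_)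
  · rw [card_confF A k (fun a ha => (hA a ha).2.1), nsmul_eq_mul,
      ENNReal.ofReal_mul (by positivity)]
    refine mul_le_mul_left ?_ _
    rw [← Nat.cast_pow, ENNReal.ofReal_natCast]
  · intro γ hγ
    obtain ⟨_, h2, h3⟩ := confF_prop A k y hA m γ hγ
    refine ENNReal.ofReal_le_ofReal (Real.exp_le_exp.2 (neg_le_neg ?_))
    have := PotR_upper hpos hm h3
    rwa [h2] at this

lemma lam0_lower_k {d : ℕ} (hd : 1 ≤ d) {φ : ℕ → ℝ} (hpos : ∀ n, 0 ≤ φ n) (hm : Monotone φ)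
    (hSL : Filter.Tendsto (fun n : ℕ => φ n / n) Filter.atTop (nhds 0))
    (lam0 : ℝ)
    (hlam0 : Filter.Tendsto (fun n : ℕ => Real.log (ZR d φ n).toReal / n) Filter.atTop
      (nhds lam0)) (k : ℕ) (hk : 1 ≤ k) :
    Real.log (stepF d).card - d * (Real.log (2 * k + 1) / k) ≤ lam0 := by
  obtain ⟨y, hy⟩ := exists_end (d := d) k
  set A := (pathF d k).filter fun γ => γ.sum = y with hAdef
  have hA : ∀ a ∈ A, IsPath a ∧ a.length = k ∧ a.sum = y := by
    intro a ha
    obtain ⟨h1, h2⟩ := Finset.mem_filter.1 ha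
    obtain ⟨h3, h4⟩ := (mem_pathF _ _).1 h1
    exact ⟨h3, h4, h2⟩
  have hc : 1 ≤ (stepF d).card := stepF_card_pos hd
  have hcpos : 0 < (stepF d).card ^ k := by positivity
  have hApos : 0 < A.card := by
    rcases Nat.eq_zero_or_pos A.card with h | h
    · rw [h, mul_zero] at hy; omega
    · exact h
  have hApos' : (0 : ℝ) < A.card := by exact_mod_cast hApos
  have hkR : (0 : ℝ) < k := by exact_mod_cast hk
  have hlogA : k * Real.log (stepF d).card - d * Real.log (2 * k + 1) ≤ Real.log A.card := by
    have h1 : ((stepF d).card : ℝ) ^ k ≤ (2 * k + 1) ^ d * A.card := by exact_mod_cast hy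
    have h2 := Real.log_le_log (by exact_mod_cast hcpos) h1
    rw [Real.log_pow, Real.log_mul (by positivity) (by positivity), Real.log_pow] at h2
    linarith
  set B : ℝ := (2 * (2 * k : ℕ) + 1) ^ d with hB
  have hsub : Tendsto (fun m : ℕ => 2 * k * m) atTop atTop :=
    tendsto_id.const_mul_atTop' (by omega : 0 < 2 * k)
  have hT : Tendsto (fun n : ℕ => φ (n + 1) / n) atTop (𝓝 0) := by
    have h1 : Tendsto (fun n : ℕ => φ (n + 1) / ((n + 1 : ℕ) : ℝ)) atTop (𝓝 0) :=
      hSL.comp (tendsto_add_atTop_nat 1)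
    have h2 : Tendsto (fun n : ℕ => 2 * (φ (n + 1) / ((n + 1 : ℕ) : ℝ))) atTop (𝓝 0) := by
      simpa using h1.const_mul 2
    refine squeeze_zero' (Eventually.of_forall fun n => by have := hpos (n+1); positivity) ?_ h2
    filter_upwards [eventually_ge_atTop 1] with n hn
    have hn' : (1 : ℝ) ≤ n := by exact_mod_cast hn
    rw [← mul_div_assoc, div_le_div_iff₀ (by positivity) (by positivity)]
    push_cast
    nlinarith [hpos (n + 1)]
  have hL := hlam0.comp hsub
  have hR : Tendsto (fun m : ℕ => Real.log A.card / k - B * (φ (2 * k * m + 1) / ((2 * k * m : ℕ) : ℝ)))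
      atTop (𝓝 (Real.log A.card / k - B * 0)) :=
    tendsto_const_nhds.sub ((hT.comp hsub).const_mul B)
  have hle : Real.log A.card / k - B * 0 ≤ lam0 := by
    refine le_of_tendsto_of_tendsto hR hL ?_
    filter_upwards [eventually_ge_atTop 1] with m hmm
    have hmR : (0 : ℝ) < m := by exact_mod_cast hmm
    have h1 := ZR_lower hpos hm A k y hA m
    have h2 := Real.log_le_log (by positivity) h1
    rw [Real.log_mul (by positivity) (by positivity), Real.log_pow, Real.log_exp] at h2
    simp only [Function.comp]
    rw [le_div_iff₀ (by push_cast; positivity)]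
    refine le_trans (le_of_eq ?_) h2
    push_cast
    rw [hB]
    push_cast
    field_simp
    ring
  refine le_trans ?_ hle
  rw [mul_zero, sub_zero, le_div_iff₀ hkR]
  refine le_trans (le_of_eq ?_) hlogA
  field_simp

lemma lam0_lower {d : ℕ} (hd : 1 ≤ d) {φ : ℕ → ℝ} (hpos : ∀ n, 0 ≤ φ n) (hm : Monotone φ)
    (hSL : Filter.Tendsto (fun n : ℕ => φ n / n) Filter.atTop (nhds 0))
    (lam0 : ℝ)
    (hlam0 : Filter.Tendsto (fun n : ℕ => Real.log (ZR d φ n).toReal / n) Filter.atTop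
      (nhds lam0)) :
    Real.log (stepF d).card ≤ lam0 := by
  have hlog : Tendsto (fun k : ℕ => Real.log (2 * k + 1) / (k : ℝ)) atTop (𝓝 0) := by
    have h1 : Tendsto (fun x : ℝ => Real.log x / x) atTop (𝓝 0) := by
      simpa using Real.isLittleO_log_id_atTop.tendsto_div_nhds_zero
    have h2 : Tendsto (fun k : ℕ => (2 * k + 1 : ℝ)) atTop atTop :=
      tendsto_atTop_add_const_right _ _
        (tendsto_natCast_atTop_atTop.const_mul_atTop (by norm_num))
    have h3 : Tendsto (fun k : ℕ => 3 * (Real.log (2 * k + 1) / (2 * k + 1 : ℝ))) atTop (𝓝 0) := by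
      simpa using (h1.comp h2).const_mul 3
    refine squeeze_zero' (Eventually.of_forall fun n => ?_) ?_ h3
    · have := Real.log_nonneg (show (1 : ℝ) ≤ 2 * n + 1 by linarith [n.cast_nonneg (α := ℝ)])
      positivity
    · filter_upwards [eventually_ge_atTop 1] with n hn
      have hn' : (1 : ℝ) ≤ n := by exact_mod_cast hn
      have := Real.log_nonneg (show (1 : ℝ) ≤ 2 * n + 1 by linarith)
      rw [← mul_div_assoc, div_le_div_iff₀ (by positivity) (by positivity)]
      nlinarith
  have h1 : Tendsto (fun k : ℕ => Real.log (stepF d).card - d * (Real.log (2 * k + 1) / (k : ℝ)))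
      atTop (𝓝 (Real.log (stepF d).card)) := by
    simpa using (tendsto_const_nhds (x := Real.log (stepF d).card)).sub (hlog.const_mul (d : ℝ))
  refine le_of_tendsto h1 ?_
  filter_upwards [eventually_ge_atTop 1] with k hk
  exact lam0_lower_k hd hpos hm hSL lam0 hlam0 k hk

lemma n1_flr {d : ℕ} (M : ℝ) (hM : 0 ≤ M) (x : Fin d → ℝ) :
    M * (∑ i, |x i|) - d ≤ n1 (flr M x) := by
  have h : ∀ i, M * |x i| - 1 ≤ ((flr M x i).natAbs : ℝ) := by
    intro i
    rw [Nat.cast_natAbs, Int.cast_abs]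
    simp only [flr]
    have h1 := Int.floor_le (M * x i)
    have h2 := Int.lt_floor_add_one (M * x i)
    have h3 : M * |x i| = |M * x i| := by rw [abs_mul, abs_of_nonneg hM]
    rw [h3]
    have h4 := abs_sub_abs_le_abs_sub (M * x i) (⌊M * x i⌋ : ℝ)
    have h5 : |M * x i - (⌊M * x i⌋ : ℝ)| ≤ 1 := abs_le.2 ⟨by linarith, by linarith⟩
    linarith
  have h6 := Finset.sum_le_sum fun i (_ : i ∈ Finset.univ) => h i
  rw [Finset.sum_sub_distrib, ← Finset.mul_sum] at h6
  simpa [n1] using h6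

lemma xi_lower {d : ℕ} (hd : 1 ≤ d) {φ : ℕ → ℝ} (hpos : ∀ n, 0 ≤ φ n) (hm : Monotone φ)
    (lam : ℝ) (hlam : Real.log (stepF d).card < lam) (x : Fin d → ℝ) (a : ℝ)
    (hξ : Filter.Tendsto (fun M : ℝ => -Real.log (HRf φ lam (flr M x)).toReal / M)
        Filter.atTop (nhds a)) : φ 1 * (∑ i, |x i|) ≤ a := by
  have hc : (0 : ℝ) < (stepF d).card := by exact_mod_cast stepF_card_pos hd
  set q : ℝ≥0∞ := ENNReal.ofReal ((stepF d).card * Real.exp (-lam)) with hq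
  have hq1 : q < 1 := by
    rw [hq, ENNReal.ofReal_lt_one]
    calc _ < ((stepF d).card : ℝ) * Real.exp (-Real.log (stepF d).card) :=
          mul_lt_mul_of_pos_left (Real.exp_lt_exp.2 (by linarith)) hc
      _ = 1 := by rw [Real.exp_neg, Real.exp_log hc, mul_inv_cancel₀ hc.ne']
  set S : ℝ≥0∞ := ∑' n : ℕ, q ^ n with hS
  have hStop : S ≠ ⊤ := by
    rw [hS, ENNReal.tsum_geometric]
    exact ENNReal.inv_ne_top.2 (tsub_pos_of_lt hq1).ne'
  have hSpos : S ≠ 0 := by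
    rw [hS, ENNReal.tsum_geometric]
    exact ENNReal.inv_ne_zero.2 (by simp)
  have hSR : 0 < S.toReal := ENNReal.toReal_pos hSpos hStop
  have hbound : ∀ y : Pt d, φ 1 * n1 y - Real.log S.toReal ≤ -Real.log (HRf φ lam y).toReal := by
    intro y
    have h1 := HRf_upper hpos hm lam y
    have htop : ENNReal.ofReal (Real.exp (-(φ 1 * n1 y))) * S ≠ ⊤ :=
      ENNReal.mul_ne_top ENNReal.ofReal_ne_top hStop
    have h2 := ENNReal.toReal_mono htop h1
    rw [ENNReal.toReal_mul, ENNReal.toReal_ofReal (Real.exp_pos _).le] at h2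
    have h3 : 0 < (HRf φ lam y).toReal :=
      ENNReal.toReal_pos (HRf_pos _ _ _) (ne_top_of_le_ne_top htop h1)
    have h4 := Real.log_le_log h3 h2
    rw [Real.log_mul (Real.exp_pos _).ne' hSR.ne', Real.log_exp] at h4
    linarith
  have hinv : Tendsto (fun M : ℝ => M⁻¹) atTop (𝓝 0) := tendsto_inv_atTop_zero
  have hR : Tendsto (fun M : ℝ => φ 1 * (∑ i, |x i|) - (φ 1 * d + Real.log S.toReal) * M⁻¹) atTop
      (𝓝 (φ 1 * (∑ i, |x i|))) := by
    simpa using (tendsto_const_nhds (x := φ 1 * (∑ i, |x i|))).sub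
      (hinv.const_mul (φ 1 * d + Real.log S.toReal))
  refine le_of_tendsto_of_tendsto hR hξ ?_
  filter_upwards [eventually_gt_atTop 0] with M hM
  rw [le_div_iff₀ hM]
  have h1 := hbound (flr M x)
  have h2 := mul_le_mul_of_nonneg_left (n1_flr M hM.le x) (hpos 1)
  have h3 : (φ 1 * (∑ i, |x i|) - (φ 1 * d + Real.log S.toReal) * M⁻¹) * M
      = φ 1 * (M * (∑ i, |x i|) - d) - Real.log S.toReal := by
    field_simp
    ring
  rw [h3]
  linarith

/-- attractive case with (SL): `ξ_λ(x) ≥ φ(1)·‖x‖₁` for every `λ > λ₀`; in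
particular, if `φ(1) > 0` then the limiting exponent `ξ_{λ₀} = lim_{λ↓λ₀} ξ_λ` is strictly
positive away from the origin. -/
theorem stmt10 (d : ℕ) (hd : 1 ≤ d) (φ : ℕ → ℝ)
    (hpos : ∀ n, 0 ≤ φ n) (hN0 : φ 0 = 0) (hNmono : Monotone φ)
    (hA : ∀ l m : ℕ, φ (l + m) ≤ φ l + φ m)
    (hSL : Filter.Tendsto (fun n : ℕ => φ n / n) Filter.atTop (nhds 0))
    (lam0 : ℝ)
    (hlam0 : Filter.Tendsto (fun n : ℕ => Real.log (ZR d φ n).toReal / n) Filter.atTop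
      (nhds lam0))
    (ξ : ℝ → (Fin d → ℝ) → ℝ)
    (hξ : ∀ lam : ℝ, lam0 < lam → ∀ x : Fin d → ℝ,
      Filter.Tendsto (fun M : ℝ => -Real.log (HRf φ lam (flr M x)).toReal / M)
        Filter.atTop (nhds (ξ lam x))) :
    (∀ lam : ℝ, lam0 < lam → ∀ x : Fin d → ℝ, φ 1 * (∑ i, |x i|) ≤ ξ lam x) ∧
    (0 < φ 1 → ∀ x : Fin d → ℝ, x ≠ 0 → ∀ ξ0x : ℝ,
      Filter.Tendsto (fun lam : ℝ => ξ lam x) (nhdsWithin lam0 (Set.Ioi lam0)) (nhds ξ0x) →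
      0 < ξ0x) := by
  have hl := lam0_lower hd hpos hNmono hSL lam0 hlam0
  have main : ∀ lam : ℝ, lam0 < lam → ∀ x : Fin d → ℝ, φ 1 * (∑ i, |x i|) ≤ ξ lam x :=
    fun lam h x => xi_lower hd hpos hNmono lam (hl.trans_lt h) x _ (hξ lam h x)
  refine ⟨main, fun h1 x hx ξ0x hlim => ?_⟩
  have hx1 : 0 < ∑ i, |x i| := by
    obtain ⟨i, hi⟩ := Function.ne_iff.1 hx
    exact Finset.sum_pos' (fun _ _ => abs_nonneg _) ⟨i, Finset.mem_univ i, abs_pos.2 hi⟩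
  refine (mul_pos h1 hx1).trans_le (ge_of_tendsto hlim ?_)
  filter_upwards [self_mem_nhdsWithin] with lam h
  exact main lam h x
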